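/- Let B be a real m×m matrix, let N ≥ 1, and let L be the square matrix of size N·m, organized as an N×N array of m×m blocks, with the identity I_m on the block diagonal, −B on the first block subdiagonal, and 0 elsewhere. Then L is invertible; the (i, j) block of L⁻¹ equals B^{i−j} for i ≥ j and 0 for i < j; ‖L‖ ≤ 1 + ‖B‖; and ‖L⁻¹‖ ≤ Σ_{k=0}^{N−1} ‖B‖^k. In particular, if ‖B‖ ≤ 1 then every singular value of L lies in the interval [1/N, 2]. -/

import Mathlib

open Matrix

noncomputable def specNorm {𝕜 : Type*} [RCLike 𝕜] {m n : Type*} [Fintype m] [Fintype n]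
    [DecidableEq n] (M : Matrix m n 𝕜) : ℝ :=
  ‖(Matrix.toEuclideanLin M).toContinuousLinearMap‖

def IsSingularValue {𝕜 : Type*} [RCLike 𝕜] {n : Type*} [Fintype n] [DecidableEq n]
    (M : Matrix n n 𝕜) (σ : ℝ) : Prop :=
  0 ≤ σ ∧ algebraMap ℝ 𝕜 (σ ^ 2) ∈ spectrum 𝕜 (M * Mᴴ)

/-- The `N·m × N·m` block matrix, organized as an `N × N` array of `m × m` blocks, with
`D` on the block diagonal, `S` on the first block subdiagonal, and `0` elsewhere. -/
def blockBidiag {N m : ℕ} (D S : Matrix (Fin m) (Fin m) ℝ) :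
    Matrix (Fin N × Fin m) (Fin N × Fin m) ℝ :=
  fun p q =>
    if p.1 = q.1 then D p.2 q.2
    else if (p.1 : ℕ) = (q.1 : ℕ) + 1 then S p.2 q.2 else 0

open scoped Matrix.Norms.L2Operator Kronecker

theorem specNorm_eq_norm {𝕜 : Type*} [RCLike 𝕜] {m n : Type*} [Fintype m] [Fintype n]
    [DecidableEq n] (M : Matrix m n 𝕜) : specNorm M = ‖M‖ :=
  rfl

theorem Matrix.l2_opNorm_one_le {n : Type*} [Fintype n] [DecidableEq n] :
    ‖(1 : Matrix n n ℝ)‖ ≤ 1 := by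
  rw [← diagonal_one, l2_opNorm_diagonal]
  exact (pi_norm_le_iff_of_nonneg zero_le_one).2 fun _ => by simp

theorem Matrix.l2_opNorm_one_kronecker_le {ι n : Type*} [Fintype ι] [DecidableEq ι] [Fintype n]
    [DecidableEq n] (B : Matrix n n ℝ) : ‖(1 : Matrix ι ι ℝ) ⊗ₖ B‖ ≤ ‖B‖ := by
  rw [l2_opNorm_def]
  refine ContinuousLinearMap.opNorm_le_bound _ (norm_nonneg _) fun x => ?_
  refine le_of_sq_le_sq ?_ (by positivity)
  have h (i : ι) := pow_le_pow_left₀ (norm_nonneg _)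
    (l2_opNorm_mulVec B (WithLp.toLp 2 fun a => x (i, a))) 2
  simp only [mul_pow, EuclideanSpace.real_norm_sq_eq] at h ⊢
  rw [Fintype.sum_prod_type, Fintype.sum_prod_type, Finset.mul_sum]
  refine Finset.sum_le_sum fun i _ => le_trans (le_of_eq ?_) (h i)
  refine Finset.sum_congr rfl fun a _ => ?_
  simp [Matrix.mulVec, dotProduct, Fintype.sum_prod_type, one_apply, ite_mul]

/-- The `N × N` nilpotent shift, with ones on the first subdiagonal. -/
def lowerShift (N : ℕ) : Matrix (Fin N) (Fin N) ℝ :=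
  Matrix.of fun i j => if (i : ℕ) = (j : ℕ) + 1 then 1 else 0

theorem lowerShift_apply (N : ℕ) (i j : Fin N) :
    lowerShift N i j = if (i : ℕ) = (j : ℕ) + 1 then 1 else 0 :=
  rfl

theorem lowerShift_pow_apply (N k : ℕ) (i j : Fin N) :
    (lowerShift N ^ k) i j = if (i : ℕ) = (j : ℕ) + k then 1 else 0 := by
  induction k generalizing i j with
  | zero => simp [one_apply, Fin.ext_iff]
  | succ k ih =>
    rw [pow_succ, mul_apply]
    simp only [ih, lowerShift_apply, mul_ite, mul_one, mul_zero]
    by_cases h : (i : ℕ) = j + (k + 1)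
    · rw [if_pos h, Finset.sum_eq_single (⟨j + 1, by omega⟩ : Fin N)]
      · rw [if_pos rfl, if_pos (by simp only; omega)]
      · intro b _ hb
        exact if_neg fun h' => hb (Fin.ext h')
      · simp
    · rw [if_neg h]
      refine Finset.sum_eq_zero fun l _ => ?_
      split_ifs <;> first | rfl | omega

theorem norm_lowerShift_kronecker_one_le (N : ℕ) {n : Type*} [Fintype n] [DecidableEq n] :
    ‖lowerShift N ⊗ₖ (1 : Matrix n n ℝ)‖ ≤ 1 := by
  have h : (lowerShift N ⊗ₖ (1 : Matrix n n ℝ))ᴴ * (lowerShift N ⊗ₖ (1 : Matrix n n ℝ)) =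
      diagonal fun p => if (p.1 : ℕ) + 1 < N then 1 else 0 := by
    rw [conjTranspose_kronecker, ← mul_kronecker_mul, conjTranspose_one, one_mul]
    have hZ : (lowerShift N)ᴴ * lowerShift N =
        diagonal fun j : Fin N => if (j : ℕ) + 1 < N then (1 : ℝ) else 0 := by
      ext i j
      simp only [mul_apply, conjTranspose_apply, lowerShift_apply, star_trivial, mul_ite,
        mul_one, mul_zero, diagonal_apply]
      by_cases hj : (j : ℕ) + 1 < N
      · rw [Finset.sum_eq_single (⟨j + 1, hj⟩ : Fin N)]
        · by_cases hij : i = j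
          · simp [hij, hj]
          · have : ¬ (j : ℕ) = i := fun h => hij (Fin.ext h.symm)
            simp [hij, this]
        · intro b _ hb
          exact if_neg fun h' => hb (Fin.ext h')
        · simp
      · rw [Finset.sum_eq_zero fun l _ => if_neg (by omega)]
        by_cases hij : i = j
        · simp [hij, hj]
        · simp [hij]
    rw [hZ, ← diagonal_one, diagonal_kronecker_diagonal]
    simp
  have h1 := l2_opNorm_conjTranspose_mul_self (lowerShift N ⊗ₖ (1 : Matrix n n ℝ))
  rw [h, l2_opNorm_diagonal] at h1
  have h2 : ‖fun p : Fin N × n => if (p.1 : ℕ) + 1 < N then (1 : ℝ) else 0‖ ≤ 1 :=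
    (pi_norm_le_iff_of_nonneg zero_le_one).2 fun p => by split_ifs <;> simp
  nlinarith [norm_nonneg (lowerShift N ⊗ₖ (1 : Matrix n n ℝ))]

theorem norm_lowerShift_kronecker_le (N : ℕ) {n : Type*} [Fintype n] [DecidableEq n]
    (B : Matrix n n ℝ) : ‖lowerShift N ⊗ₖ B‖ ≤ ‖B‖ := by
  have h : lowerShift N ⊗ₖ B = (lowerShift N ⊗ₖ 1) * (1 ⊗ₖ B) := by
    rw [← mul_kronecker_mul, mul_one, one_mul]
  rw [h]
  exact (l2_opNorm_mul _ _).trans <| (mul_le_mul (norm_lowerShift_kronecker_one_le N)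
    (l2_opNorm_one_kronecker_le B) (norm_nonneg _) zero_le_one).trans_eq (one_mul _)

theorem lowerShift_kronecker_pow (N : ℕ) {n : Type*} [Fintype n] [DecidableEq n]
    (B : Matrix n n ℝ) (k : ℕ) : (lowerShift N ⊗ₖ B) ^ k = (lowerShift N ^ k) ⊗ₖ (B ^ k) := by
  induction k with
  | zero => simp
  | succ k ih => rw [pow_succ, ih, ← mul_kronecker_mul, ← pow_succ, ← pow_succ]

theorem blockBidiag_one_neg {N m : ℕ} (B : Matrix (Fin m) (Fin m) ℝ) :
    (blockBidiag 1 (-B) : Matrix (Fin N × Fin m) (Fin N × Fin m) ℝ) =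
      1 - lowerShift N ⊗ₖ B := by
  ext ⟨i, a⟩ ⟨j, b⟩
  by_cases h : i = j
  · subst h
    simp [blockBidiag, lowerShift, one_apply]
  · by_cases h' : (i : ℕ) = j + 1 <;> simp [blockBidiag, lowerShift, one_apply, h, h']

theorem Matrix.norm_pow_le_of_norm_le {n : Type*} [Fintype n] [DecidableEq n]
    {S : Matrix n n ℝ} {c : ℝ} (h : ‖S‖ ≤ c) (k : ℕ) : ‖S ^ k‖ ≤ c ^ k := by
  induction k with
  | zero => simpa using l2_opNorm_one_le
  | succ k ih =>
    rw [pow_succ, pow_succ]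
    exact (l2_opNorm_mul _ _).trans
      (mul_le_mul ih h (norm_nonneg _) (pow_nonneg ((norm_nonneg _).trans h) _))

theorem Matrix.abs_le_norm_of_mem_spectrum {n : Type*} [Fintype n] [DecidableEq n]
    {A : Matrix n n ℝ} {r : ℝ} (h : r ∈ spectrum ℝ A) : |r| ≤ ‖A‖ :=
  (spectrum.norm_le_norm_mul_of_mem h).trans
    (mul_le_of_le_one_right (norm_nonneg _) l2_opNorm_one_le)

theorem IsSingularValue.le_norm {n : Type*} [Fintype n] [DecidableEq n]
    {A : Matrix n n ℝ} {σ : ℝ} (h : IsSingularValue A σ) : σ ≤ ‖A‖ := by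
  refine le_of_sq_le_sq ?_ (norm_nonneg _)
  refine (le_abs_self _).trans ((abs_le_norm_of_mem_spectrum h.2).trans ?_)
  refine (l2_opNorm_mul _ _).trans_eq ?_
  rw [l2_opNorm_conjTranspose, sq]

theorem IsSingularValue.one_le_mul_norm_inv {n : Type*} [Fintype n] [DecidableEq n]
    {A : Matrix n n ℝ} (hA : IsUnit A) {σ : ℝ} (h : IsSingularValue A σ) :
    1 ≤ σ * ‖A⁻¹‖ := by
  obtain ⟨h0, hs⟩ := h
  simp only [Algebra.algebraMap_self, RingHom.id_apply] at hs
  have hu : IsUnit (A * Aᴴ) := hA.mul hA.star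
  have hσ : σ ^ 2 ≠ 0 := by
    rintro h
    exact spectrum.zero_mem_iff ℝ |>.1 (h ▸ hs) hu
  have hinv : (σ ^ 2)⁻¹ ∈ spectrum ℝ (A * Aᴴ)⁻¹ := by
    have := (spectrum.inv_mem_iff (r := Units.mk0 _ hσ) (a := hu.unit)).1 hs
    rw [← hu.unit_spec, ← coe_units_inv]
    simpa using this
  have hle : (σ ^ 2)⁻¹ ≤ ‖A⁻¹‖ ^ 2 := by
    refine (le_abs_self _).trans ((abs_le_norm_of_mem_spectrum hinv).trans ?_)
    rw [Matrix.mul_inv_rev, ← conjTranspose_nonsing_inv]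
    refine (l2_opNorm_mul _ _).trans_eq ?_
    rw [l2_opNorm_conjTranspose, sq]
  have hpos : 0 < σ ^ 2 := lt_of_le_of_ne (sq_nonneg _) hσ.symm
  rw [inv_le_iff_one_le_mul₀' hpos, ← mul_pow] at hle
  exact (one_le_sq_iff₀ (mul_nonneg h0 (norm_nonneg _))).1 hle

/-- **Block lower-bidiagonal inverse and norm bounds.** For `B` a real `m × m` matrix,
`N ≥ 1` and `L` the `N·m × N·m` block bidiagonal matrix with `I` on the block diagonal
and `-B` on the first block subdiagonal: `L` is invertible; the `(i,j)` block of `L⁻¹`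
equals `B^(i-j)` for `i ≥ j` and `0` for `i < j`; `‖L‖ ≤ 1 + ‖B‖`;
`‖L⁻¹‖ ≤ ∑_{k<N} ‖B‖^k`; and if `‖B‖ ≤ 1` then every singular value of `L` lies in
`[1/N, 2]`. -/
theorem stmt9 (m N : ℕ) (hN : 1 ≤ N) (B : Matrix (Fin m) (Fin m) ℝ)
    (L : Matrix (Fin N × Fin m) (Fin N × Fin m) ℝ)
    (hL : L = blockBidiag 1 (-B)) :
    IsUnit L ∧
    (∀ (i j : Fin N) (a b : Fin m),
      L⁻¹ (i, a) (j, b) = if (j : ℕ) ≤ (i : ℕ) then (B ^ ((i : ℕ) - (j : ℕ))) a b else 0) ∧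
    specNorm L ≤ 1 + specNorm B ∧
    specNorm L⁻¹ ≤ ∑ k ∈ Finset.range N, specNorm B ^ k ∧
    (specNorm B ≤ 1 →
      ∀ σ : ℝ, IsSingularValue L σ → 1 / N ≤ σ ∧ σ ≤ 2) := by
  subst hL
  simp only [specNorm_eq_norm, blockBidiag_one_neg]
  set S := lowerShift N ⊗ₖ B with hS
  have hpow : S ^ N = 0 := by
    have hZ : lowerShift N ^ N = 0 := by
      ext i j
      rw [lowerShift_pow_apply, if_neg (by omega), Matrix.zero_apply]
    rw [hS, lowerShift_kronecker_pow, hZ, zero_kronecker]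
  have hmul : (1 - S) * ∑ k ∈ Finset.range N, S ^ k = 1 := by
    rw [mul_neg_geom_sum, hpow, sub_zero]
  have hunit : IsUnit (1 - S) := .of_mul_eq_one _ hmul
  have hinv : (1 - S)⁻¹ = ∑ k ∈ Finset.range N, S ^ k := inv_eq_right_inv hmul
  have hnorm : ‖S‖ ≤ ‖B‖ := norm_lowerShift_kronecker_le N B
  have hLnorm : ‖1 - S‖ ≤ 1 + ‖B‖ :=
    (norm_sub_le _ _).trans (add_le_add l2_opNorm_one_le hnorm)
  have hinvnorm : ‖(1 - S)⁻¹‖ ≤ ∑ k ∈ Finset.range N, ‖B‖ ^ k := by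
    rw [hinv]
    exact norm_sum_le_of_le _ fun k _ => norm_pow_le_of_norm_le hnorm k
  refine ⟨hunit, fun i j a b => ?_, hLnorm, hinvnorm, fun hB σ hσ => ⟨?_, ?_⟩⟩
  · rw [hinv, Matrix.sum_apply]
    simp only [hS, lowerShift_kronecker_pow, kroneckerMap_apply, lowerShift_pow_apply, ite_mul,
      one_mul, zero_mul]
    split_ifs with hij
    · rw [Finset.sum_eq_single ((i : ℕ) - j)]
      · rw [if_pos (by omega)]
      · intro k _ hk
        exact if_neg (by omega)
      · intro hk
        exact absurd (Finset.mem_range.2 (by omega)) hk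
    · exact Finset.sum_eq_zero fun k _ => if_neg (by omega)
  · have hsum : ∑ k ∈ Finset.range N, ‖B‖ ^ k ≤ N :=
      (Finset.sum_le_sum fun k _ => pow_le_one₀ (norm_nonneg B) hB).trans (by simp)
    rw [div_le_iff₀ (by exact_mod_cast hN)]
    exact (hσ.one_le_mul_norm_inv hunit).trans
      (mul_le_mul_of_nonneg_left (hinvnorm.trans hsum) hσ.1)
  · linarith [hσ.le_norm]
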